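/- Let F : ℋ → 𝒦 be a rigging operator and let H_0, H_1 be self-adjoint operators on ℋ with H_1 − H_0 ∈ F*ℬ_sa(𝒦)F. Then for every λ ∈ Λ(H_0, F) ∩ Λ(H_1, F) there exist bounded operators w_±(λ; H_1, H_0) : 𝔥_λ(H_0) → 𝔥_λ(H_1) of norm ≤ 1, the wave matrices, uniquely determined by ⟨𝔈_λ(H_1)f, w_±(λ; H_1, H_0) 𝔈_λ(H_0)g⟩ = lim_{y→0^+} (y/π) ⟨R_{λ±iy}(H_1)f, R_{λ±iy}(H_0)g⟩ for all f, g ∈ ran F*. Moreover, writing H_1 − H_0 = F*JF, they satisfy √(Im T_{λ+i0}(H_1)) w_±(λ; H_1, H_0) √(Im T_{λ+i0}(H_0)) = lim_{y→0^+} y F R_{λ∓iy}(H_1) R_{λ±iy}(H_0) F*, √(Im T_{λ+i0}(H_1)) w_±(λ; H_1, H_0) = (1 − T_{λ∓i0}(H_1)J) √(Im T_{λ+i0}(H_0)), and w_±(λ; H_1, H_0) √(Im T_{λ+i0}(H_0)) = √(Im T_{λ+i0}(H_1)) (1 + J T_{λ±i0}(H_0)). -/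

import Mathlib

open MeasureTheory Filter Complex Set Topology
open scoped InnerProductSpace ComplexInnerProductSpace ENNReal Topology Real
set_option autoImplicit false

noncomputable section

namespace SSF

variable {𝓗 : Type*} {𝓚 : Type*}

section TraceClass

variable [NormedAddCommGroup 𝓗] [InnerProductSpace ℂ 𝓗]
variable [NormedAddCommGroup 𝓚] [InnerProductSpace ℂ 𝓚]

/-- A bounded operator `T` on a Hilbert space is trace class iff the sums
`∑ |⟪e i, T (f i)⟫|` over finite orthonormal families `e,f` are uniformly bounded. -/
def IsTraceClass (T : 𝓗 →L[ℂ] 𝓗) : Prop :=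
  ∃ C : ℝ, ∀ (n : ℕ) (e f : Fin n → 𝓗), Orthonormal ℂ e → Orthonormal ℂ f →
    ∑ i, ‖⟪e i, T (f i)⟫_ℂ‖ ≤ C

/-- The trace norm of a bounded operator: the supremum of `∑ |⟪e i, T (f i)⟫|` over
finite orthonormal families `e,f`. -/
def traceNorm (T : 𝓗 →L[ℂ] 𝓗) : ℝ :=
  sSup {c : ℝ | ∃ (n : ℕ) (e f : Fin n → 𝓗), Orthonormal ℂ e ∧ Orthonormal ℂ f ∧
    c = ∑ i, ‖⟪e i, T (f i)⟫_ℂ‖}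

/-- The trace of a bounded operator, computed in a Hilbert basis (meaningful for
trace class operators). -/
def trace [CompleteSpace 𝓗] (T : 𝓗 →L[ℂ] 𝓗) : ℂ :=
  ∑' i : (exists_hilbertBasis ℂ 𝓗).choose, ⟪(i : 𝓗), T (i : 𝓗)⟫_ℂ

/-- A bounded operator between Hilbert spaces is Hilbert-Schmidt iff the sums
`∑ ‖T (e i)‖ ^ 2` over finite orthonormal families are uniformly bounded. -/
def IsHilbertSchmidt (T : 𝓗 →L[ℂ] 𝓚) : Prop :=
  ∃ C : ℝ, ∀ (n : ℕ) (e : Fin n → 𝓗), Orthonormal ℂ e → ∑ i, ‖T (e i)‖ ^ 2 ≤ C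

end TraceClass

variable [NormedAddCommGroup 𝓗] [InnerProductSpace ℂ 𝓗] [CompleteSpace 𝓗]
variable [NormedAddCommGroup 𝓚] [InnerProductSpace ℂ 𝓚] [CompleteSpace 𝓚]

/-- A (possibly unbounded) self-adjoint operator on a Hilbert space, bundled together
with its resolvent `R_z = (H - z)⁻¹` at every nonreal `z`. -/
structure SelfAdjointOperator (𝓗 : Type*) [NormedAddCommGroup 𝓗]
    [InnerProductSpace ℂ 𝓗] [CompleteSpace 𝓗] where
  domain : Submodule ℂ 𝓗
  dense_domain : Dense (domain : Set 𝓗)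
  op : domain →ₗ[ℂ] 𝓗
  symmetric : ∀ f g : domain, ⟪op f, (g : 𝓗)⟫_ℂ = ⟪(f : 𝓗), op g⟫_ℂ
  resolvent : ℂ → (𝓗 →L[ℂ] 𝓗)
  resolvent_mem : ∀ z : ℂ, z.im ≠ 0 → ∀ f : 𝓗, resolvent z f ∈ domain
  resolvent_right : ∀ (z : ℂ) (hz : z.im ≠ 0) (f : 𝓗),
    op ⟨resolvent z f, resolvent_mem z hz f⟩ - z • resolvent z f = f
  resolvent_left : ∀ (z : ℂ), z.im ≠ 0 → ∀ g : domain,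
    resolvent z (op g - z • (g : 𝓗)) = (g : 𝓗)

/-- `IsSum H0 V H1` encodes the relation `H1 = H0 + V` for a bounded perturbation `V`,
via the second resolvent identity (which characterises it uniquely). -/
def IsSum (H0 : SelfAdjointOperator 𝓗) (V : 𝓗 →L[ℂ] 𝓗)
    (H1 : SelfAdjointOperator 𝓗) : Prop :=
  ∀ z : ℂ, z.im ≠ 0 →
    H1.resolvent z - H0.resolvent z = -(H1.resolvent z ∘L (V ∘L H0.resolvent z))

/-- Two self-adjoint operators are resolvent comparable if the difference of their
resolvents at some (hence any) nonreal point is trace class. -/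
def ResolventComparable (H0 H1 : SelfAdjointOperator 𝓗) : Prop :=
  ∃ z : ℂ, z.im ≠ 0 ∧ IsTraceClass (H1.resolvent z - H0.resolvent z)

/-- The spectral measure of a self-adjoint operator `H`, bundled with the associated
scalar spectral measures, the Borel functional calculus, and the decomposition into
absolutely continuous and singular parts. -/
structure SpectralMeasure (H : SelfAdjointOperator 𝓗) where
  proj : Set ℝ → (𝓗 →L[ℂ] 𝓗)
  proj_sa : ∀ s, IsSelfAdjoint (proj s)
  proj_mul : ∀ s t, proj (s ∩ t) = proj s ∘L proj t
  proj_univ : proj Set.univ = 1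
  scalar : 𝓗 → Measure ℝ
  scalar_finite : ∀ f, IsFiniteMeasure (scalar f)
  scalar_spec : ∀ (f : 𝓗) (s : Set ℝ), MeasurableSet s →
    (scalar f s).toReal = (⟪f, proj s f⟫_ℂ).re
  resolvent_spec : ∀ (z : ℂ), z.im ≠ 0 → ∀ f : 𝓗,
    ⟪f, H.resolvent z f⟫_ℂ = ∫ x : ℝ, ((x : ℂ) - z)⁻¹ ∂(scalar f)
  fc : (ℝ → ℂ) → (𝓗 →L[ℂ] 𝓗)
  fc_spec : ∀ (φ : ℝ → ℂ), Measurable φ → (∃ C, ∀ x, ‖φ x‖ ≤ C) →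
    ∀ f : 𝓗, ⟪f, fc φ f⟫_ℂ = ∫ x : ℝ, φ x ∂(scalar f)
  acProj : Set ℝ → (𝓗 →L[ℂ] 𝓗)
  sProj : Set ℝ → (𝓗 →L[ℂ] 𝓗)
  acProj_add_sProj : ∀ s, acProj s + sProj s = proj s
  acScalar : 𝓗 → Measure ℝ
  sScalar : 𝓗 → Measure ℝ
  acScalar_spec : ∀ (f : 𝓗) (s : Set ℝ), MeasurableSet s →
    (acScalar f s).toReal = (⟪f, acProj s f⟫_ℂ).re
  sScalar_spec : ∀ (f : 𝓗) (s : Set ℝ), MeasurableSet s →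
    (sScalar f s).toReal = (⟪f, sProj s f⟫_ℂ).re
  acScalar_ac : ∀ f, acScalar f ≪ MeasureTheory.volume
  sScalar_sing : ∀ f, (sScalar f).MutuallySingular MeasureTheory.volume

/-- The real-valued test function version of the functional calculus. -/
def SpectralMeasure.fcR {H : SelfAdjointOperator 𝓗} (E : SpectralMeasure H)
    (φ : ℝ → ℝ) : 𝓗 →L[ℂ] 𝓗 :=
  E.fc fun x => (φ x : ℂ)


/-- A rigging operator: a bounded operator with trivial kernel and dense range. -/
def IsRigging (F : 𝓗 →L[ℂ] 𝓚) : Prop :=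
  Function.Injective F ∧ Dense (Set.range F)

/-- The perturbation `F* J F` determined by a rigging `F` and a bounded operator `J`. -/
def sandwich (F : 𝓗 →L[ℂ] 𝓚) (J : 𝓚 →L[ℂ] 𝓚) : 𝓗 →L[ℂ] 𝓗 :=
  ContinuousLinearMap.adjoint F ∘L (J ∘L F)

/-- The sandwiched resolvent `T_z(H) = F R_z(H) F*`. -/
def Tz (F : 𝓗 →L[ℂ] 𝓚) (H : SelfAdjointOperator 𝓗) (z : ℂ) : 𝓚 →L[ℂ] 𝓚 :=
  F ∘L (H.resolvent z ∘L ContinuousLinearMap.adjoint F)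

/-- The imaginary part `Im T = (T - T*)/2i` of a bounded operator. -/
def imOp (T : 𝓚 →L[ℂ] 𝓚) : 𝓚 →L[ℂ] 𝓚 :=
  ((2 * Complex.I)⁻¹) • (T - ContinuousLinearMap.adjoint T)

/-- `Λ(H,F)`: the set of real points `l` at which the norm limit
`T_{l+i0}(H) = lim_{y→0⁺} T_{l+iy}(H)` exists. -/
def LambdaSet (F : 𝓗 →L[ℂ] 𝓚) (H : SelfAdjointOperator 𝓗) : Set ℝ :=
  {l : ℝ | ∃ L : 𝓚 →L[ℂ] 𝓚,
    Tendsto (fun y : ℝ => Tz F H ((l : ℂ) + y * Complex.I)) (𝓝[>] (0:ℝ)) (𝓝 L)}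

/-- The norm limit `T_{l+i0}(H)` (meaningful for `l ∈ Λ(H,F)`). -/
def Tlim (F : 𝓗 →L[ℂ] 𝓚) (H : SelfAdjointOperator 𝓗) (l : ℝ) : 𝓚 →L[ℂ] 𝓚 :=
  limUnder (𝓝[>] (0:ℝ)) (fun y : ℝ => Tz F H ((l : ℂ) + y * Complex.I))

/-- Convergence in trace norm along a filter. -/
def TendstoTraceNorm (f : ℝ → (𝓚 →L[ℂ] 𝓚)) (lf : Filter ℝ) (L : 𝓚 →L[ℂ] 𝓚) : Prop :=
  (∀ᶠ y in lf, IsTraceClass (f y - L)) ∧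
  Tendsto (fun y : ℝ => traceNorm (f y - L)) lf (𝓝 0)

/-- `Λ(H,F;𝓛₁)`: the set of points `l ∈ Λ(H,F)` at which additionally
`Im T_{l+i0}(H)` exists in trace class. -/
def LambdaSetTC (F : 𝓗 →L[ℂ] 𝓚) (H : SelfAdjointOperator 𝓗) : Set ℝ :=
  {l : ℝ | l ∈ LambdaSet F H ∧ ∃ M : 𝓚 →L[ℂ] 𝓚, IsTraceClass M ∧
    TendstoTraceNorm (fun y : ℝ => imOp (Tz F H ((l : ℂ) + y * Complex.I)))
      (𝓝[>] (0:ℝ)) M}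

/-- `F` is an `H`-Hilbert-Schmidt rigging operator. -/
def IsHSRigging (F : 𝓗 →L[ℂ] 𝓚) (H : SelfAdjointOperator 𝓗) : Prop :=
  IsRigging F ∧ ∃ z : ℂ, z.im ≠ 0 ∧ IsHilbertSchmidt (F ∘L H.resolvent z)

/-- The fibre Hilbert space `𝔥_λ(H)`: the closure of the range of
`Q = √(Im T_{λ+i0}(H))`. -/
def fibSpace (Q : 𝓚 →L[ℂ] 𝓚) : Submodule ℂ 𝓚 :=
  (LinearMap.range (Q : 𝓚 →ₗ[ℂ] 𝓚)).topologicalClosure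

/-- The element `Q ψ` of the fibre space. -/
def toFib (Q : 𝓚 →L[ℂ] 𝓚) (ψ : 𝓚) : fibSpace Q :=
  ⟨Q ψ, Submodule.le_topologicalClosure _ (LinearMap.mem_range_self _ ψ)⟩

/-- `Q`, corestricted to the fibre space. -/
def codToFib (Q : 𝓚 →L[ℂ] 𝓚) : 𝓚 →L[ℂ] (fibSpace Q) :=
  Q.codRestrict (fibSpace Q) fun ψ =>
    Submodule.le_topologicalClosure _ (LinearMap.mem_range_self _ ψ)

/-- `Q` is the positive square root of `Im T_{l+i0}(H)`. -/
def IsSqrtImT (F : 𝓗 →L[ℂ] 𝓚) (H : SelfAdjointOperator 𝓗) (l : ℝ)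
    (Q : 𝓚 →L[ℂ] 𝓚) : Prop :=
  IsSelfAdjoint Q ∧ (∀ ψ : 𝓚, 0 ≤ (⟪ψ, Q ψ⟫_ℂ).re) ∧ Q ∘L Q = imOp (Tlim F H l)

/-- The defining property of the wave matrix `w_±(l; H₁, H₀)` (`ε = 1` for `w₊`,
`ε = -1` for `w₋`), given positive square roots `Q₁, Q₀` of `Im T_{l+i0}(H₁)`,
`Im T_{l+i0}(H₀)`: it is a contraction `𝔥_l(H₀) → 𝔥_l(H₁)` determined by
`⟪𝔈_l(H₁)f, w_± 𝔈_l(H₀)g⟫ = lim_{y→0⁺} (y/π)⟪R_{l±iy}(H₁)f, R_{l±iy}(H₀)g⟫`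
for `f, g ∈ ran F*`. -/
def IsWaveMatrix (F : 𝓗 →L[ℂ] 𝓚) (H₁ H₀ : SelfAdjointOperator 𝓗)
    (Q₁ Q₀ : 𝓚 →L[ℂ] 𝓚) (l : ℝ) (ε : ℝ)
    (w : fibSpace Q₀ →L[ℂ] fibSpace Q₁) : Prop :=
  ‖w‖ ≤ 1 ∧ ∀ φ ψ : 𝓚,
    Tendsto (fun y : ℝ =>
        (y : ℂ) * ⟪H₁.resolvent ((l : ℂ) + (ε : ℂ) * y * Complex.I)
            (ContinuousLinearMap.adjoint F φ),
          H₀.resolvent ((l : ℂ) + (ε : ℂ) * y * Complex.I)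
            (ContinuousLinearMap.adjoint F ψ)⟫_ℂ)
      (𝓝[>] (0:ℝ)) (𝓝 ⟪Q₁ φ, ((w (toFib Q₀ ψ)) : 𝓚)⟫_ℂ)

/-- Pointwise application of an `L²` element (via its canonical representative). -/
def lpApply {μ : Measure ℝ} (g : MeasureTheory.Lp 𝓚 2 μ) (l : ℝ) : 𝓚 :=
  (g : ℝ →ₘ[μ] 𝓚) l

section WaveMatrices

open ContinuousLinearMap

open scoped ComplexConjugate

/-- The first resolvent identity. -/
theorem SelfAdjointOperator.resolvent_sub_resolvent (H : SelfAdjointOperator 𝓗) {z w : ℂ}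
    (hz : z.im ≠ 0) (hw : w.im ≠ 0) :
    H.resolvent z - H.resolvent w = (z - w) • (H.resolvent w ∘L H.resolvent z) := by
  ext f
  have hleft := H.resolvent_left w hw ⟨H.resolvent z f, H.resolvent_mem z hz f⟩
  have hright := H.resolvent_right z hz f
  rw [sub_eq_iff_eq_add] at hright
  rw [hright, add_sub_assoc, ← sub_smul, map_add, map_smul] at hleft
  simp only [sub_apply, smul_apply, comp_apply]
  exact sub_eq_of_eq_add' hleft.symm

theorem SelfAdjointOperator.adjoint_resolvent (H : SelfAdjointOperator 𝓗) {z : ℂ}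
    (hz : z.im ≠ 0) : adjoint (H.resolvent z) = H.resolvent (conj z) := by
  have hz' : (conj z).im ≠ 0 := by simpa using hz
  symm
  rw [eq_adjoint_iff]
  intro f g
  have hf := H.resolvent_right (conj z) hz' f
  have hg := H.resolvent_right z hz g
  have hsymm := H.symmetric ⟨_, H.resolvent_mem (conj z) hz' f⟩ ⟨_, H.resolvent_mem z hz g⟩
  conv_lhs => rw [← hg]
  conv_rhs => rw [← hf]
  rw [inner_sub_left, inner_sub_right, inner_smul_left, inner_smul_right, hsymm, conj_conj]

theorem adjoint_Tz (F : 𝓗 →L[ℂ] 𝓚) (H : SelfAdjointOperator 𝓗) {z : ℂ} (hz : z.im ≠ 0) :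
    adjoint (Tz F H z) = Tz F H (conj z) := by
  simp only [Tz, adjoint_comp, adjoint_adjoint, H.adjoint_resolvent hz, comp_assoc]

/-- The sandwiched product `F R_{z̄}(H₁) R_z(H₀) F*`. -/
def resolventProd (F : 𝓗 →L[ℂ] 𝓚) (H₁ H₀ : SelfAdjointOperator 𝓗) (z : ℂ) : 𝓚 →L[ℂ] 𝓚 :=
  F ∘L (H₁.resolvent (conj z) ∘L (H₀.resolvent z ∘L adjoint F))

theorem im_smul_resolventProd_self (F : 𝓗 →L[ℂ] 𝓚) (H : SelfAdjointOperator 𝓗) {z : ℂ}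
    (hz : z.im ≠ 0) : (z.im : ℂ) • resolventProd F H H z = imOp (Tz F H z) := by
  have hz' : (conj z).im ≠ 0 := by simpa using hz
  have hsub : Tz F H z - Tz F H (conj z) = (z - conj z) • resolventProd F H H z := by
    have h := congrArg (fun A => F ∘L (A ∘L adjoint F)) (H.resolvent_sub_resolvent hz hz')
    simpa [Tz, resolventProd, sub_comp, comp_sub, smul_comp, comp_smul, comp_assoc] using h
  rw [imOp, adjoint_Tz F H hz, hsub, smul_smul, sub_conj]
  congr 1
  push_cast
  field_simp

theorem inner_resolventProd (F : 𝓗 →L[ℂ] 𝓚) (H₁ H₀ : SelfAdjointOperator 𝓗) {z : ℂ}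
    (hz : z.im ≠ 0) (φ ψ : 𝓚) :
    ⟪φ, resolventProd F H₁ H₀ z ψ⟫_ℂ =
      ⟪H₁.resolvent z (adjoint F φ), H₀.resolvent z (adjoint F ψ)⟫_ℂ := by
  simp only [resolventProd, comp_apply, ← H₁.adjoint_resolvent hz, ← adjoint_inner_left F,
    adjoint_inner_right]

section Perturbation

variable {F : 𝓗 →L[ℂ] 𝓚} {H₀ H₁ : SelfAdjointOperator 𝓗} {J : 𝓚 →L[ℂ] 𝓚}

theorem IsSum.resolventProd_eq_left (hH : IsSum H₀ (sandwich F J) H₁) {z : ℂ} (hz : z.im ≠ 0) :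
    resolventProd F H₁ H₀ z =
      (1 - adjoint (Tz F H₁ z) ∘L J) ∘L resolventProd F H₀ H₀ z := by
  have hz' : (conj z).im ≠ 0 := by simpa using hz
  rw [adjoint_Tz F H₁ hz]
  ext ψ
  have h := congrArg (fun A => A (H₀.resolvent z (adjoint F ψ))) (hH _ hz')
  simp only [sub_apply, neg_apply, comp_apply, sandwich] at h
  rw [sub_eq_iff_eq_add] at h
  simp only [resolventProd, Tz, comp_apply, sub_apply, one_apply_eq_self, h, map_add, map_neg]
  abel

theorem IsSum.resolventProd_eq_right (hH : IsSum H₀ (sandwich F J) H₁) {z : ℂ} (hz : z.im ≠ 0) :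
    resolventProd F H₁ H₀ z = resolventProd F H₁ H₁ z ∘L (1 + J ∘L Tz F H₀ z) := by
  ext ψ
  have h := congrArg (fun A => A (adjoint F ψ)) (hH _ hz)
  simp only [sub_apply, neg_apply, comp_apply, sandwich] at h
  rw [sub_eq_iff_eq_add'] at h
  simp only [resolventProd, Tz, comp_apply, add_apply, one_apply_eq_self, map_add, h, map_neg]
  abel

end Perturbation

/-- `Q` is self-adjoint and `Q²` is the boundary value at `l` of `y F R_{z̄}(H) R_z(H) F*` along
`z = l + iεy`, `y → 0⁺`, while `S` is the boundary value of `T_z(H)`. -/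
structure IsBoundaryValue (F : 𝓗 →L[ℂ] 𝓚) (H : SelfAdjointOperator 𝓗) (l ε : ℝ)
    (S Q : 𝓚 →L[ℂ] 𝓚) : Prop where
  isSelfAdjoint : IsSelfAdjoint Q
  tendsto_Tz : Tendsto (fun y : ℝ => Tz F H ((l : ℂ) + (ε : ℂ) * y * Complex.I)) (𝓝[>] (0:ℝ)) (𝓝 S)
  tendsto_resolventProd : Tendsto
    (fun y : ℝ => (y : ℂ) • resolventProd F H H ((l : ℂ) + (ε : ℂ) * y * Complex.I))
    (𝓝[>] (0:ℝ)) (𝓝 (Q ∘L Q))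

theorem eventually_im_ne_zero (l : ℝ) {ε : ℝ} (hε : ε ≠ 0) :
    ∀ᶠ y : ℝ in 𝓝[>] (0:ℝ), ((l : ℂ) + (ε : ℂ) * y * Complex.I).im ≠ 0 := by
  filter_upwards [self_mem_nhdsWithin] with y hy
  simpa using And.intro hε (ne_of_gt hy)

theorem tendsto_Tlim {F : 𝓗 →L[ℂ] 𝓚} {H : SelfAdjointOperator 𝓗} {l : ℝ}
    (hl : l ∈ LambdaSet F H) :
    Tendsto (fun y : ℝ => Tz F H ((l : ℂ) + y * Complex.I)) (𝓝[>] (0:ℝ)) (𝓝 (Tlim F H l)) :=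
  tendsto_nhds_limUnder hl

theorem continuous_imOp : Continuous (imOp : (𝓚 →L[ℂ] 𝓚) → (𝓚 →L[ℂ] 𝓚)) :=
  .const_smul (continuous_id.sub (adjoint (𝕜 := ℂ) (E := 𝓚) (F := 𝓚)).continuous) (2 * Complex.I)⁻¹

theorem IsSqrtImT.isBoundaryValue_one {F : 𝓗 →L[ℂ] 𝓚} {H : SelfAdjointOperator 𝓗} {l : ℝ}
    {Q : 𝓚 →L[ℂ] 𝓚} (hQ : IsSqrtImT F H l Q) (hl : l ∈ LambdaSet F H) :
    IsBoundaryValue F H l 1 (Tlim F H l) Q where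
  isSelfAdjoint := hQ.1
  tendsto_Tz := by simpa using tendsto_Tlim hl
  tendsto_resolventProd := by
    rw [hQ.2.2]
    refine ((continuous_imOp.tendsto _).comp (tendsto_Tlim hl)).congr' ?_
    filter_upwards [eventually_im_ne_zero l one_ne_zero] with y hy
    have h := im_smul_resolventProd_self F H hy
    simp only [ofReal_one, one_mul] at h ⊢
    simpa using h.symm

theorem IsSqrtImT.isBoundaryValue_neg_one {F : 𝓗 →L[ℂ] 𝓚} {H : SelfAdjointOperator 𝓗} {l : ℝ}
    {Q : 𝓚 →L[ℂ] 𝓚} (hQ : IsSqrtImT F H l Q) (hl : l ∈ LambdaSet F H) :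
    IsBoundaryValue F H l (-1) (adjoint (Tlim F H l)) Q := by
  have hT : Tendsto (fun y : ℝ => Tz F H ((l : ℂ) + ((-1 : ℝ) : ℂ) * y * Complex.I)) (𝓝[>] (0:ℝ))
      (𝓝 (adjoint (Tlim F H l))) := by
    refine (((adjoint (𝕜 := ℂ) (E := 𝓚) (F := 𝓚)).continuous.tendsto _).comp
      (tendsto_Tlim hl)).congr' ?_
    filter_upwards [eventually_im_ne_zero l one_ne_zero] with y hy
    simp only [ofReal_one, one_mul] at hy
    simp [adjoint_Tz F H hy]
  refine ⟨hQ.1, hT, ?_⟩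
  have hQQ : Q ∘L Q = -imOp (adjoint (Tlim F H l)) := by
    rw [hQ.2.2, imOp, imOp, adjoint_adjoint, ← smul_neg, neg_sub]
  rw [hQQ]
  refine ((continuous_imOp.tendsto _).comp hT).neg.congr' ?_
  filter_upwards [eventually_im_ne_zero l (neg_ne_zero.mpr one_ne_zero)] with y hy
  have h := im_smul_resolventProd_self F H hy
  rw [Function.comp_apply, ← h, ← neg_smul]
  simp

theorem IsBoundaryValue.tendsto_norm_sq {F : 𝓗 →L[ℂ] 𝓚} {H : SelfAdjointOperator 𝓗} {l ε : ℝ}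
    {S Q : 𝓚 →L[ℂ] 𝓚} (h : IsBoundaryValue F H l ε S Q) (hε : ε ≠ 0) (φ : 𝓚) :
    Tendsto (fun y : ℝ =>
      y * ‖H.resolvent ((l : ℂ) + (ε : ℂ) * y * Complex.I) (adjoint F φ)‖ ^ 2)
      (𝓝[>] (0:ℝ)) (𝓝 (‖Q φ‖ ^ 2)) := by
  have hlim : Tendsto (fun y : ℝ => (⟪φ, ((y : ℂ) •
      resolventProd F H H ((l : ℂ) + (ε : ℂ) * y * Complex.I)) φ⟫_ℂ).re)
      (𝓝[>] (0:ℝ)) (𝓝 (⟪φ, (Q ∘L Q) φ⟫_ℂ).re) :=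
    ((by fun_prop : Continuous fun A : 𝓚 →L[ℂ] 𝓚 => (⟪φ, A φ⟫_ℂ).re).tendsto _).comp
      h.tendsto_resolventProd
  have hval : (⟪φ, (Q ∘L Q) φ⟫_ℂ).re = ‖Q φ‖ ^ 2 := by
    rw [comp_apply, ← adjoint_inner_left, h.isSelfAdjoint.adjoint_eq, inner_self_eq_norm_sq_to_K]
    norm_cast
  rw [← hval]
  refine hlim.congr' ?_
  filter_upwards [eventually_im_ne_zero l hε] with y hy
  rw [smul_apply, inner_smul_right, inner_resolventProd F H H hy, inner_self_eq_norm_sq_to_K, re_ofReal_mul]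
  norm_cast

section Fibre

variable {E : Type*} [NormedAddCommGroup E] [InnerProductSpace ℂ E] (Q : E →L[ℂ] E)

theorem denseRange_codToFib : DenseRange (codToFib Q) := by
  intro x
  rw [closure_subtype]
  have himage : ((↑) '' Set.range (codToFib Q) : Set E) = Set.range Q := by
    rw [← Set.range_comp]
    rfl
  rw [himage]
  exact x.2

theorem ext_fibSpace {X : Type*} [NormedAddCommGroup X] [NormedSpace ℂ X]
    {A B : fibSpace Q →L[ℂ] X} (h : A ∘L codToFib Q = B ∘L codToFib Q) : A = B := by
  refine ContinuousLinearMap.coeFn_injective ?_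
  exact (denseRange_codToFib Q).equalizer A.continuous B.continuous
    (funext fun ψ => congrArg (fun C => C ψ) h)

theorem eq_of_inner_fibSpace {Q : E →L[ℂ] E} {u v : fibSpace Q}
    (h : ∀ φ, ⟪Q φ, (u : E)⟫_ℂ = ⟪Q φ, (v : E)⟫_ℂ) : u = v :=
  (denseRange_codToFib Q).eq_of_inner_right ℂ h

end Fibre

theorem inner_self_comp_self {Q : 𝓚 →L[ℂ] 𝓚} (hQ : IsSelfAdjoint Q) (φ ψ : 𝓚) :
    ⟪φ, Q (Q ψ)⟫_ℂ = ⟪Q φ, Q ψ⟫_ℂ := by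
  rw [← adjoint_inner_left, hQ.adjoint_eq]

section Core

variable {F : 𝓗 →L[ℂ] 𝓚} {H₀ H₁ : SelfAdjointOperator 𝓗} {J : 𝓚 →L[ℂ] 𝓚} {l ε : ℝ}
  {S₀ S₁ Q₀ Q₁ : 𝓚 →L[ℂ] 𝓚}

theorem tendsto_resolventProd_left (hH : IsSum H₀ (sandwich F J) H₁) (hε : ε ≠ 0)
    (h₀ : IsBoundaryValue F H₀ l ε S₀ Q₀) (h₁ : IsBoundaryValue F H₁ l ε S₁ Q₁) :
    Tendsto (fun y : ℝ => (y : ℂ) • resolventProd F H₁ H₀ ((l : ℂ) + (ε : ℂ) * y * Complex.I))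
      (𝓝[>] (0:ℝ)) (𝓝 ((1 - adjoint S₁ ∘L J) ∘L (Q₀ ∘L Q₀))) := by
  have hcont : Continuous fun p : (𝓚 →L[ℂ] 𝓚) × (𝓚 →L[ℂ] 𝓚) =>
      (1 - adjoint p.1 ∘L J) ∘L p.2 :=
    (continuous_const.sub
      (((adjoint (𝕜 := ℂ) (E := 𝓚) (F := 𝓚)).continuous.comp continuous_fst).clm_comp
        continuous_const)).clm_comp continuous_snd
  refine ((hcont.tendsto (S₁, Q₀ ∘L Q₀)).comp
    (h₁.tendsto_Tz.prodMk_nhds h₀.tendsto_resolventProd)).congr' ?_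
  filter_upwards [eventually_im_ne_zero l hε] with y hy
  simp only [Function.comp_apply, hH.resolventProd_eq_left hy, comp_smul]

theorem tendsto_resolventProd_right (hH : IsSum H₀ (sandwich F J) H₁) (hε : ε ≠ 0)
    (h₀ : IsBoundaryValue F H₀ l ε S₀ Q₀) (h₁ : IsBoundaryValue F H₁ l ε S₁ Q₁) :
    Tendsto (fun y : ℝ => (y : ℂ) • resolventProd F H₁ H₀ ((l : ℂ) + (ε : ℂ) * y * Complex.I))
      (𝓝[>] (0:ℝ)) (𝓝 ((Q₁ ∘L Q₁) ∘L (1 + J ∘L S₀))) := by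
  have hcont : Continuous fun p : (𝓚 →L[ℂ] 𝓚) × (𝓚 →L[ℂ] 𝓚) => p.2 ∘L (1 + J ∘L p.1) :=
    continuous_snd.clm_comp
      (continuous_const.add (continuous_const.clm_comp continuous_fst))
  refine ((hcont.tendsto (S₀, Q₁ ∘L Q₁)).comp
    (h₀.tendsto_Tz.prodMk_nhds h₁.tendsto_resolventProd)).congr' ?_
  filter_upwards [eventually_im_ne_zero l hε] with y hy
  simp only [Function.comp_apply, hH.resolventProd_eq_right hy, smul_comp]

theorem tendsto_inner_resolvent (hε : ε ≠ 0) {L : 𝓚 →L[ℂ] 𝓚}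
    (hL : Tendsto (fun y : ℝ => (y : ℂ) •
      resolventProd F H₁ H₀ ((l : ℂ) + (ε : ℂ) * y * Complex.I)) (𝓝[>] (0:ℝ)) (𝓝 L)) (φ ψ : 𝓚) :
    Tendsto (fun y : ℝ => (y : ℂ) *
      ⟪H₁.resolvent ((l : ℂ) + (ε : ℂ) * y * Complex.I) (adjoint F φ),
        H₀.resolvent ((l : ℂ) + (ε : ℂ) * y * Complex.I) (adjoint F ψ)⟫_ℂ)
      (𝓝[>] (0:ℝ)) (𝓝 ⟪φ, L ψ⟫_ℂ) := by
  refine (((by fun_prop : Continuous fun A : 𝓚 →L[ℂ] 𝓚 => ⟪φ, A ψ⟫_ℂ).tendsto _).comp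
    hL).congr' ?_
  filter_upwards [eventually_im_ne_zero l hε] with y hy
  simp only [Function.comp_apply, smul_apply, inner_smul_right, inner_resolventProd F H₁ H₀ hy]

theorem inner_limit_sq_le (hε : ε ≠ 0)
    (h₀ : IsBoundaryValue F H₀ l ε S₀ Q₀) (h₁ : IsBoundaryValue F H₁ l ε S₁ Q₁)
    {L : 𝓚 →L[ℂ] 𝓚} (hL : Tendsto (fun y : ℝ => (y : ℂ) •
      resolventProd F H₁ H₀ ((l : ℂ) + (ε : ℂ) * y * Complex.I)) (𝓝[>] (0:ℝ)) (𝓝 L)) (φ ψ : 𝓚) :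
    ‖⟪φ, L ψ⟫_ℂ‖ ^ 2 ≤ ‖Q₁ φ‖ ^ 2 * ‖Q₀ ψ‖ ^ 2 := by
  refine le_of_tendsto_of_tendsto ((tendsto_inner_resolvent hε hL φ ψ).norm.pow 2)
    ((h₁.tendsto_norm_sq hε φ).mul (h₀.tendsto_norm_sq hε ψ)) ?_
  filter_upwards with y
  rw [norm_mul, mul_pow, norm_real, Real.norm_eq_abs, sq_abs]
  have h := pow_le_pow_left₀ (norm_nonneg _)
    (norm_inner_le_norm (𝕜 := ℂ) (H₁.resolvent ((l : ℂ) + (ε : ℂ) * y * Complex.I) (adjoint F φ))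
      (H₀.resolvent ((l : ℂ) + (ε : ℂ) * y * Complex.I) (adjoint F ψ))) 2
  nlinarith [mul_le_mul_of_nonneg_left h (sq_nonneg y)]

theorem norm_comp_le (hH : IsSum H₀ (sandwich F J) H₁) (hε : ε ≠ 0)
    (h₀ : IsBoundaryValue F H₀ l ε S₀ Q₀) (h₁ : IsBoundaryValue F H₁ l ε S₁ Q₁) (ψ : 𝓚) :
    ‖Q₁ ((1 + J ∘L S₀) ψ)‖ ≤ ‖Q₀ ψ‖ := by
  have h := inner_limit_sq_le hε h₀ h₁ (tendsto_resolventProd_right hH hε h₀ h₁)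
    ((1 + J ∘L S₀) ψ) ψ
  set χ := (1 + J ∘L S₀) ψ with hχ
  rw [comp_apply, comp_apply, ← hχ, inner_self_comp_self h₁.isSelfAdjoint,
    inner_self_eq_norm_sq_to_K, norm_pow, RCLike.norm_ofReal, abs_norm] at h
  by_contra! hlt
  have hpos : 0 < ‖Q₁ χ‖ := (norm_nonneg _).trans_lt hlt
  have hsq : ‖Q₀ ψ‖ ^ 2 < ‖Q₁ χ‖ ^ 2 := pow_lt_pow_left₀ hlt (norm_nonneg _) two_ne_zero
  nlinarith [mul_lt_mul_of_pos_left hsq (pow_pos hpos 2)]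

theorem isWaveMatrix_iff (hH : IsSum H₀ (sandwich F J) H₁) (hε : ε ≠ 0)
    (h₀ : IsBoundaryValue F H₀ l ε S₀ Q₀) (h₁ : IsBoundaryValue F H₁ l ε S₁ Q₁)
    (w : fibSpace Q₀ →L[ℂ] fibSpace Q₁) :
    IsWaveMatrix F H₁ H₀ Q₁ Q₀ l ε w ↔
      ‖w‖ ≤ 1 ∧ w ∘L codToFib Q₀ = codToFib Q₁ ∘L (1 + J ∘L S₀) := by
  have hlim := tendsto_inner_resolvent hε (tendsto_resolventProd_right hH hε h₀ h₁)
  refine and_congr_right fun _ => ⟨fun h => ?_, fun h φ ψ => ?_⟩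
  · ext1 ψ
    refine eq_of_inner_fibSpace fun φ => ?_
    refine (tendsto_nhds_unique (h φ ψ) (hlim φ ψ)).trans ?_
    exact inner_self_comp_self h₁.isSelfAdjoint _ _
  · convert hlim φ ψ using 2
    have hψ : w (toFib Q₀ ψ) = codToFib Q₁ ((1 + J ∘L S₀) ψ) := congrArg (fun A => A ψ) h
    rw [hψ]
    exact (inner_self_comp_self h₁.isSelfAdjoint _ _).symm

theorem existsUnique_isWaveMatrix (hH : IsSum H₀ (sandwich F J) H₁) (hε : ε ≠ 0)
    (h₀ : IsBoundaryValue F H₀ l ε S₀ Q₀) (h₁ : IsBoundaryValue F H₁ l ε S₁ Q₁) :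
    ∃! w : fibSpace Q₀ →L[ℂ] fibSpace Q₁, IsWaveMatrix F H₁ H₀ Q₁ Q₀ l ε w := by
  simp only [isWaveMatrix_iff hH hε h₀ h₁]
  have : CompleteSpace (fibSpace Q₁) :=
    (Submodule.isClosed_topologicalClosure _).completeSpace_coe
  have hbound : ∀ ψ, ‖((codToFib Q₁ ∘L (1 + J ∘L S₀) : 𝓚 →L[ℂ] fibSpace Q₁) :
      𝓚 →ₗ[ℂ] fibSpace Q₁) ψ‖ ≤ 1 * ‖(codToFib Q₀ : 𝓚 →ₗ[ℂ] fibSpace Q₀) ψ‖ := fun ψ => by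
    rw [one_mul]
    exact norm_comp_le hH hε h₀ h₁ ψ
  refine ⟨LinearMap.extendOfNorm _ (codToFib Q₀ : 𝓚 →ₗ[ℂ] fibSpace Q₀),
    ⟨LinearMap.opNorm_extendOfNorm_le (denseRange_codToFib Q₀) zero_le_one hbound, ?_⟩, ?_⟩
  · ext1 ψ
    exact LinearMap.extendOfNorm_eq (denseRange_codToFib Q₀) ⟨1, hbound⟩ ψ
  · rintro w ⟨hw, hw'⟩
    refine ext_fibSpace Q₀ (hw'.trans ?_)
    ext1 ψ
    exact (LinearMap.extendOfNorm_eq (denseRange_codToFib Q₀) ⟨1, hbound⟩ ψ).symm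

theorem IsWaveMatrix.identities (hH : IsSum H₀ (sandwich F J) H₁) (hε : ε ≠ 0)
    (h₀ : IsBoundaryValue F H₀ l ε S₀ Q₀) (h₁ : IsBoundaryValue F H₁ l ε S₁ Q₁)
    {w : fibSpace Q₀ →L[ℂ] fibSpace Q₁} (hw : IsWaveMatrix F H₁ H₀ Q₁ Q₀ l ε w) :
    Tendsto (fun y : ℝ => (y : ℂ) • resolventProd F H₁ H₀ ((l : ℂ) + (ε : ℂ) * y * Complex.I))
      (𝓝[>] (0:ℝ)) (𝓝 (Q₁ ∘L ((fibSpace Q₁).subtypeL ∘L (w ∘L codToFib Q₀)))) ∧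
    Q₁ ∘L ((fibSpace Q₁).subtypeL ∘L w)
      = ((1 - adjoint S₁ ∘L J) ∘L Q₀) ∘L (fibSpace Q₀).subtypeL ∧
    (fibSpace Q₁).subtypeL ∘L (w ∘L codToFib Q₀) = Q₁ ∘L (1 + J ∘L S₀) := by
  have hwQ : (fibSpace Q₁).subtypeL ∘L (w ∘L codToFib Q₀) = Q₁ ∘L (1 + J ∘L S₀) := by
    rw [((isWaveMatrix_iff hH hε h₀ h₁ w).mp hw).2]
    rfl
  have hlim : Tendsto (fun y : ℝ => (y : ℂ) •
      resolventProd F H₁ H₀ ((l : ℂ) + (ε : ℂ) * y * Complex.I))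
      (𝓝[>] (0:ℝ)) (𝓝 (Q₁ ∘L ((fibSpace Q₁).subtypeL ∘L (w ∘L codToFib Q₀)))) := by
    rw [hwQ, ← comp_assoc]
    exact tendsto_resolventProd_right hH hε h₀ h₁
  exact ⟨hlim, ext_fibSpace Q₀
    (tendsto_nhds_unique hlim (tendsto_resolventProd_left hH hε h₀ h₁)), hwQ⟩

end Core

end WaveMatrices

/-- For `H₁ − H₀ = F*JF` and `l ∈ Λ(H₀,F) ∩ Λ(H₁,F)` there exist
unique wave matrices `w_±(l; H₁, H₀) : 𝔥_l(H₀) → 𝔥_l(H₁)` of norm `≤ 1` determined by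
`⟪𝔈_l(H₁)f, w_± 𝔈_l(H₀)g⟫ = lim_{y→0⁺}(y/π)⟪R_{l±iy}(H₁)f, R_{l±iy}(H₀)g⟫`, and they
satisfy the boundary versions of the identities (a(z)), (Ew), (wE). -/
theorem wave_matrices_exist_unique_and_identities
    (𝓗 𝓚 : Type) [NormedAddCommGroup 𝓗] [InnerProductSpace ℂ 𝓗] [CompleteSpace 𝓗]
    [NormedAddCommGroup 𝓚] [InnerProductSpace ℂ 𝓚] [CompleteSpace 𝓚]
    (F : 𝓗 →L[ℂ] 𝓚) (hF : IsRigging F)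
    (H₀ H₁ : SelfAdjointOperator 𝓗)
    (J : 𝓚 →L[ℂ] 𝓚) (hJ : IsSelfAdjoint J) (hH : IsSum H₀ (sandwich F J) H₁)
    (l : ℝ) (hl0 : l ∈ LambdaSet F H₀) (hl1 : l ∈ LambdaSet F H₁)
    (Q₀ Q₁ : 𝓚 →L[ℂ] 𝓚) (hQ₀ : IsSqrtImT F H₀ l Q₀) (hQ₁ : IsSqrtImT F H₁ l Q₁) :
    -- existence and uniqueness of `w₊` and `w₋`
    (∀ ε : ℝ, ε = 1 ∨ ε = -1 →
      ∃! w : fibSpace Q₀ →L[ℂ] fibSpace Q₁, IsWaveMatrix F H₁ H₀ Q₁ Q₀ l ε w) ∧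
    -- the identities for `w₊`
    (∀ w : fibSpace Q₀ →L[ℂ] fibSpace Q₁, IsWaveMatrix F H₁ H₀ Q₁ Q₀ l 1 w →
      Tendsto (fun y : ℝ => (y : ℂ) •
          (F ∘L (H₁.resolvent ((l : ℂ) - y * Complex.I) ∘L
            (H₀.resolvent ((l : ℂ) + y * Complex.I) ∘L ContinuousLinearMap.adjoint F))))
        (𝓝[>] (0:ℝ))
        (𝓝 (Q₁ ∘L ((fibSpace Q₁).subtypeL ∘L (w ∘L codToFib Q₀)))) ∧
      Q₁ ∘L ((fibSpace Q₁).subtypeL ∘L w)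
        = ((1 - ContinuousLinearMap.adjoint (Tlim F H₁ l) ∘L J) ∘L Q₀) ∘L
            (fibSpace Q₀).subtypeL ∧
      (fibSpace Q₁).subtypeL ∘L (w ∘L codToFib Q₀)
        = Q₁ ∘L (1 + J ∘L Tlim F H₀ l)) ∧
    -- the identities for `w₋`
    (∀ w : fibSpace Q₀ →L[ℂ] fibSpace Q₁, IsWaveMatrix F H₁ H₀ Q₁ Q₀ l (-1) w →
      Tendsto (fun y : ℝ => (y : ℂ) •
          (F ∘L (H₁.resolvent ((l : ℂ) + y * Complex.I) ∘L
            (H₀.resolvent ((l : ℂ) - y * Complex.I) ∘L ContinuousLinearMap.adjoint F))))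
        (𝓝[>] (0:ℝ))
        (𝓝 (Q₁ ∘L ((fibSpace Q₁).subtypeL ∘L (w ∘L codToFib Q₀)))) ∧
      Q₁ ∘L ((fibSpace Q₁).subtypeL ∘L w)
        = ((1 - Tlim F H₁ l ∘L J) ∘L Q₀) ∘L (fibSpace Q₀).subtypeL ∧
      (fibSpace Q₁).subtypeL ∘L (w ∘L codToFib Q₀)
        = Q₁ ∘L (1 + J ∘L ContinuousLinearMap.adjoint (Tlim F H₀ l))) := by
  have hε₁ : (1 : ℝ) ≠ 0 := one_ne_zero
  have hε₂ : (-1 : ℝ) ≠ 0 := neg_ne_zero.mpr one_ne_zero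
  have hp₀ := hQ₀.isBoundaryValue_one hl0
  have hp₁ := hQ₁.isBoundaryValue_one hl1
  have hm₀ := hQ₀.isBoundaryValue_neg_one hl0
  have hm₁ := hQ₁.isBoundaryValue_neg_one hl1
  refine ⟨?_, fun w hw => ?_, fun w hw => ?_⟩
  · rintro ε (rfl | rfl)
    · exact existsUnique_isWaveMatrix hH hε₁ hp₀ hp₁
    · exact existsUnique_isWaveMatrix hH hε₂ hm₀ hm₁
  · simpa [resolventProd, sub_eq_add_neg] using hw.identities hH hε₁ hp₀ hp₁
  · simpa [resolventProd, sub_eq_add_neg] using hw.identities hH hε₂ hm₀ hm₁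

end SSF
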